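/- There exists a sequence of instances (𝒯_n, w_n), where each 𝒯_n is a finite tree and w_n is the uniform distribution on V(𝒯_n), such that lim_{n→∞} OPT(𝒯_n, w_n) = ∞ and, taking for every n any centroid tree C_n of (𝒯_n, w_n), the ratio cost_{w_n}(C_n) / OPT(𝒯_n, w_n) converges to 2 as n → ∞. -/

import Mathlib

open Filter Topology

universe u

variable {V : Type u}

/-- Rooted trees with vertices labelled by elements of `V`. -/
inductive RTree (V : Type u) : Type u where
  | node : V → List (RTree V) → RTree V

namespace RTree

/-- The root of a rooted tree. -/
def root : RTree V → V
  | node r _ => r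

/-- The subtrees rooted at the children of the root. -/
def children : RTree V → List (RTree V)
  | node _ ts => ts

/-- The list of pairs `(v, path from the root to v)` over all vertices `v` of the tree. -/
def pathsFrom : RTree V → List (V × List V)
  | node r ts =>
      (r, [r]) ::
        (ts.attach.map fun t => (t.1.pathsFrom.map fun p => (p.1, r :: p.2))).flatten
  decreasing_by
    simp only [RTree.node.sizeOf_spec]
    have := List.sizeOf_lt_of_mem t.2
    omega

/-- The vertex set of a rooted tree. -/
def vertSet (T : RTree V) : Set V := {v | ∃ p ∈ T.pathsFrom, p.1 = v}

/-- `Path_T(v)`: the set of vertices on the path in `T` from the root to `v`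
(including both endpoints). -/
def pathSet (T : RTree V) (v : V) : Set V := {x | ∃ p ∈ T.pathsFrom, p.1 = v ∧ x ∈ p.2}

/-- The depth of a vertex `v` in `T`; the root has depth 1. -/
noncomputable def depth (T : RTree V) (v : V) : ℕ := (T.pathSet v).ncard

/-- All subtrees of a rooted tree (including the tree itself). -/
def allSubtrees : RTree V → List (RTree V)
  | node r ts => node r ts :: (ts.attach.map fun t => t.1.allSubtrees).flatten
  decreasing_by
    simp only [RTree.node.sizeOf_spec]
    have := List.sizeOf_lt_of_mem t.2
    omega

/-- Two rooted trees are equivalent (represent the same search tree) if they have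
the same root-to-vertex paths. -/
def Equiv (T₁ T₂ : RTree V) : Prop := ∀ v, T₁.pathSet v = T₂.pathSet v

end RTree

/-- `x` and `y` are joined by a walk of `G` staying inside `s`. -/
def ReachIn (G : SimpleGraph V) (s : Set V) (x y : V) : Prop :=
  ∃ p : G.Walk x y, ∀ v ∈ p.support, v ∈ s

/-- The connected component of `x` in the subgraph of `G` induced by `s`. -/
def compIn (G : SimpleGraph V) (s : Set V) (x : V) : Set V := {y | ReachIn G s x y}

/-- The set of connected components of the subgraph of `G` induced by `s`. -/
def comps (G : SimpleGraph V) (s : Set V) : Set (Set V) := {c | ∃ x ∈ s, c = compIn G s x}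

/-- `s` induces a (nonempty) connected subgraph of `G`. -/
def ConnIn (G : SimpleGraph V) (s : Set V) : Prop :=
  s.Nonempty ∧ ∀ x ∈ s, ∀ y ∈ s, ReachIn G s x y

/-- The total weight of a set of vertices. -/
noncomputable def wsum (w : V → ℝ) (s : Set V) : ℝ := ∑ᶠ x ∈ s, w x

/-- `IsSearchTree G s T`: `T` is a search tree on the subgraph of `G` induced by `s`.
Its root `r` is a vertex of `s`, its vertex set is `s`, and the subtrees rooted at the
children of `r` are search trees on the connected components of the induced subgraph
on `s \ {r}` (one subtree for each component). -/
inductive IsSearchTree (G : SimpleGraph V) : Set V → RTree V → Prop where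
  | node {s : Set V} {r : V} {ts : List (RTree V)} :
      r ∈ s →
      (RTree.node r ts).vertSet = s →
      (∀ t ∈ ts, IsSearchTree G (compIn G (s \ {r}) t.root) t) →
      ts.Pairwise (fun t₁ t₂ => compIn G (s \ {r}) t₁.root ≠ compIn G (s \ {r}) t₂.root) →
      IsSearchTree G s (RTree.node r ts)

/-- The cost of a search tree: `∑_x w(x) · depth(x)`, the root having depth 1. -/
noncomputable def cost (w : V → ℝ) (T : RTree V) : ℝ :=
  ∑ᶠ v ∈ T.vertSet, w v * (T.depth v : ℝ)

/-- The optimum cost of a search tree on the subgraph of `G` induced by `s`. -/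
noncomputable def OPT (G : SimpleGraph V) (w : V → ℝ) (s : Set V) : ℝ :=
  sInf (cost w '' {T | IsSearchTree G s T})

/-- `v` is an `α`-centroid of the subgraph of `G` induced by `s` (with weights `w`):
every connected component of the induced subgraph on `s \ {v}` has weight at most
`α` times the weight of `s`. -/
def IsAlphaCentroid (G : SimpleGraph V) (w : V → ℝ) (α : ℝ) (s : Set V) (v : V) : Prop :=
  v ∈ s ∧ ∀ x ∈ s \ {v}, wsum w (compIn G (s \ {v}) x) ≤ α * wsum w s

/-- `v` is a centroid of the subgraph of `G` induced by `s` (with weights `w`). -/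
def IsCentroid (G : SimpleGraph V) (w : V → ℝ) (s : Set V) (v : V) : Prop :=
  v ∈ s ∧ ∀ x ∈ s \ {v}, wsum w (compIn G (s \ {v}) x) ≤ wsum w s / 2

/-- `T` is an `α`-centroid tree on the subgraph of `G` induced by `s`. -/
def IsAlphaCentroidTree (G : SimpleGraph V) (w : V → ℝ) (α : ℝ) (s : Set V) (T : RTree V) :
    Prop :=
  IsSearchTree G s T ∧ ∀ t ∈ T.allSubtrees, IsAlphaCentroid G w α t.vertSet t.root

/-- `T` is a centroid tree on the subgraph of `G` induced by `s`. -/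
def IsCentroidTree (G : SimpleGraph V) (w : V → ℝ) (s : Set V) (T : RTree V) : Prop :=
  IsSearchTree G s T ∧ ∀ t ∈ T.allSubtrees, IsCentroid G w t.vertSet t.root

/-- `cent(𝒯,w)`: the maximum cost of a centroid tree. -/
noncomputable def centCost (G : SimpleGraph V) (w : V → ℝ) (s : Set V) : ℝ :=
  sSup (cost w '' {T | IsCentroidTree G w s T})

/-- `centᵅ(𝒯,w)`: the maximum cost of an `α`-centroid tree (`0` if none exists, since
`sSup ∅ = 0` in `ℝ`). -/
noncomputable def centCostA (G : SimpleGraph V) (w : V → ℝ) (α : ℝ) (s : Set V) : ℝ :=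
  sSup (cost w '' {T | IsAlphaCentroidTree G w α s T})

/-- `b` is a child of `a` in the rooted tree `T`. -/
def ChildRel (T : RTree V) (a b : V) : Prop :=
  ∃ t ∈ T.allSubtrees, t.root = a ∧ ∃ t' ∈ t.children, t'.root = b

namespace RTree

theorem mem_pathsFrom_node {r : V} {ts : List (RTree V)} {p : V × List V} :
    p ∈ (node r ts).pathsFrom ↔
      p = (r, [r]) ∨ ∃ t ∈ ts, ∃ q ∈ t.pathsFrom, p = (q.1, r :: q.2) := by
  rw [pathsFrom]
  simp only [List.mem_cons, List.mem_flatten, List.mem_map, List.mem_attach, true_and,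
    Subtype.exists]
  constructor
  · rintro (h | ⟨l, ⟨t, ht, rfl⟩, hp⟩)
    · exact Or.inl h
    · obtain ⟨q, hq, rfl⟩ := List.mem_map.1 hp
      exact Or.inr ⟨t, ht, q, hq, rfl⟩
  · rintro (h | ⟨t, ht, q, hq, rfl⟩)
    · exact Or.inl h
    · exact Or.inr ⟨_, ⟨t, ht, rfl⟩, List.mem_map.2 ⟨q, hq, rfl⟩⟩

theorem mem_allSubtrees_node {r : V} {ts : List (RTree V)} {t : RTree V} :
    t ∈ (node r ts).allSubtrees ↔ t = node r ts ∨ ∃ t' ∈ ts, t ∈ t'.allSubtrees := by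
  rw [allSubtrees]
  simp only [List.mem_cons, List.mem_flatten, List.mem_map, List.mem_attach, true_and,
    Subtype.exists]
  constructor
  · rintro (h | ⟨l, ⟨t', ht, rfl⟩, hp⟩)
    · exact Or.inl h
    · exact Or.inr ⟨t', ht, hp⟩
  · rintro (h | ⟨t', ht, hp⟩)
    · exact Or.inl h
    · exact Or.inr ⟨_, ⟨t', ht, rfl⟩, hp⟩

theorem self_mem_allSubtrees (T : RTree V) : T ∈ T.allSubtrees := by
  cases T
  exact mem_allSubtrees_node.2 (Or.inl rfl)

theorem mem_vertSet_node {r v : V} {ts : List (RTree V)} :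
    v ∈ (node r ts).vertSet ↔ v = r ∨ ∃ t ∈ ts, v ∈ t.vertSet := by
  simp only [vertSet, Set.mem_ofPred_eq, mem_pathsFrom_node]
  constructor
  · rintro ⟨p, rfl | ⟨t, ht, q, hq, rfl⟩, rfl⟩
    · exact Or.inl rfl
    · exact Or.inr ⟨t, ht, q, hq, rfl⟩
  · rintro (rfl | ⟨t, ht, q, hq, rfl⟩)
    · exact ⟨_, Or.inl rfl, rfl⟩
    · exact ⟨_, Or.inr ⟨t, ht, q, hq, rfl⟩, rfl⟩

theorem root_mem_vertSet (T : RTree V) : T.root ∈ T.vertSet := by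
  cases T
  exact mem_vertSet_node.2 (Or.inl rfl)

theorem root_mem_pathSet {T : RTree V} {v : V} (hv : v ∈ T.vertSet) :
    T.root ∈ T.pathSet v := by
  obtain ⟨p, hp, rfl⟩ := hv
  refine ⟨p, hp, rfl, ?_⟩
  cases T
  obtain rfl | ⟨t, ht, q, hq, rfl⟩ := mem_pathsFrom_node.1 hp <;> simp [root]

theorem pathSet_subset_pathSet_node {r v : V} {ts : List (RTree V)} {t : RTree V}
    (ht : t ∈ ts) : t.pathSet v ⊆ (node r ts).pathSet v := by
  rintro x ⟨q, hq, rfl, hx⟩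
  exact ⟨_, mem_pathsFrom_node.2 (Or.inr ⟨t, ht, q, hq, rfl⟩), rfl, List.mem_cons_of_mem _ hx⟩

/-- The sum of the lengths of all root-to-vertex paths. -/
def totalLength (T : RTree V) : ℕ := (T.pathsFrom.map fun p => p.2.length).sum

theorem totalLength_leaf (r : V) : (node r []).totalLength = 1 := by
  simp [totalLength, pathsFrom]

theorem length_pathsFrom_leaf (r : V) : (node r []).pathsFrom.length = 1 := by
  simp [pathsFrom]

theorem pathsFrom_node_cons_perm (r : V) (t : RTree V) (ts : List (RTree V)) :
    (node r (t :: ts)).pathsFrom.Perm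
      ((node r ts).pathsFrom ++ t.pathsFrom.map fun p => (p.1, r :: p.2)) := by
  have h : ∀ ts : List (RTree V), (node r ts).pathsFrom = (r, [r]) ::
      (ts.map fun t => t.pathsFrom.map fun p => (p.1, r :: p.2)).flatten := fun ts => by
    rw [pathsFrom]
    simp
  rw [h, h, List.map_cons, List.flatten_cons, List.cons_append]
  exact List.Perm.cons _ List.perm_append_comm

theorem length_pathsFrom_node_cons (r : V) (t : RTree V) (ts : List (RTree V)) :
    (node r (t :: ts)).pathsFrom.length =
      (node r ts).pathsFrom.length + t.pathsFrom.length := by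
  simpa using (pathsFrom_node_cons_perm r t ts).length_eq

theorem totalLength_node_cons (r : V) (t : RTree V) (ts : List (RTree V)) :
    (node r (t :: ts)).totalLength =
      (node r ts).totalLength + t.totalLength + t.pathsFrom.length := by
  have h := ((pathsFrom_node_cons_perm r t ts).map fun p => p.2.length).sum_eq
  simp only [List.map_append, List.sum_append, List.map_map] at h
  rw [totalLength, h, add_assoc]
  congr 1
  simp [Function.comp_def, totalLength, List.sum_map_add]

/-- The ancestor-descendant pairs of a rooted tree. -/
def ancestorPairs (T : RTree V) : Set (V × V) := {p | p.1 ∈ T.pathSet p.2}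

theorem ncard_ancestorPairs_le (T : RTree V) : T.ancestorPairs.ncard ≤ T.totalLength := by
  classical
  have h : T.ancestorPairs ⊆
      ((T.pathsFrom.map fun p => p.2.map fun u => (u, p.1)).flatten.toFinset : Set (V × V)) := by
    rintro ⟨u, v⟩ ⟨p, hp, hv, hu⟩
    simp only [List.coe_toFinset, List.mem_flatten, List.mem_map, Set.mem_ofPred_eq]
    exact ⟨_, ⟨p, hp, rfl⟩, List.mem_map.2 ⟨u, hu, by simpa using hv⟩⟩
  refine (Set.ncard_le_ncard h (Finset.finite_toSet _)).trans ?_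
  rw [Set.ncard_coe_finset]
  refine (List.toFinset_card_le _).trans ?_
  simp [totalLength, Function.comp_def]

theorem cost_eq_ncard_ancestorPairs [Finite V] {w : V → ℝ} {a : ℝ} (hw : ∀ x, w x = a)
    {T : RTree V} (hT : T.vertSet = Set.univ) : cost w T = a * T.ancestorPairs.ncard := by
  classical
  have := Fintype.ofFinite V
  have h : T.ancestorPairs.ncard = ∑ v, T.depth v := by
    have e : (T.ancestorPairs : Set (V × V)) =
        ((Finset.univ.filter fun p : V × V => p.1 ∈ T.pathSet p.2 : Finset _) : Set _) := by
      ext; simp [ancestorPairs]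
    rw [e, Set.ncard_coe_finset, Finset.card_filter, Fintype.sum_prod_type_right]
    refine Finset.sum_congr rfl fun v _ => ?_
    rw [← Finset.card_filter, depth, ← Set.ncard_coe_finset]
    simp
  simp only [cost, hT, Set.mem_univ, finsum_true, hw]
  rw [h, finsum_eq_sum_of_fintype, Nat.cast_sum, Finset.mul_sum]

end RTree

theorem ReachIn.refl {G : SimpleGraph V} {s : Set V} {x : V} (hx : x ∈ s) : ReachIn G s x x :=
  ⟨.nil, by simpa using hx⟩

theorem ReachIn.symm {G : SimpleGraph V} {s : Set V} {x y : V} (h : ReachIn G s x y) :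
    ReachIn G s y x := by
  obtain ⟨p, hp⟩ := h
  exact ⟨p.reverse, by simpa using hp⟩

theorem ReachIn.trans {G : SimpleGraph V} {s : Set V} {x y z : V} (h : ReachIn G s x y)
    (h' : ReachIn G s y z) : ReachIn G s x z := by
  obtain ⟨p, hp⟩ := h
  obtain ⟨q, hq⟩ := h'
  refine ⟨p.append q, fun v hv => ?_⟩
  rcases (SimpleGraph.Walk.mem_support_append_iff p q).1 hv with h | h
  exacts [hp v h, hq v h]

theorem ReachIn.mono {G : SimpleGraph V} {s t : Set V} (hst : s ⊆ t) {x y : V}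
    (h : ReachIn G s x y) : ReachIn G t x y := by
  obtain ⟨p, hp⟩ := h
  exact ⟨p, fun v hv => hst (hp v hv)⟩

theorem ReachIn.left_mem {G : SimpleGraph V} {s : Set V} {x y : V} (h : ReachIn G s x y) :
    x ∈ s := by
  obtain ⟨p, hp⟩ := h
  exact hp x p.start_mem_support

theorem ReachIn.right_mem {G : SimpleGraph V} {s : Set V} {x y : V} (h : ReachIn G s x y) :
    y ∈ s := h.symm.left_mem

theorem ReachIn.of_adj {G : SimpleGraph V} {s : Set V} {x y : V} (hx : x ∈ s) (hy : y ∈ s)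
    (h : G.Adj x y) : ReachIn G s x y :=
  ⟨h.toWalk, by simp [hx, hy]⟩

theorem ReachIn.of_forall_not_adj {G : SimpleGraph V} {s t : Set V}
    (h : ∀ x ∈ s, ∀ y ∈ t \ s, ¬ G.Adj x y) {x y : V} (hx : x ∈ s) (hxy : ReachIn G t x y) :
    ReachIn G s x y := by
  obtain ⟨p, hp⟩ := hxy
  induction p with
  | nil => exact .refl hx
  | @cons u v w huv p ih =>
    have hv : v ∈ s := by
      by_contra hv
      exact h u hx v ⟨hp v (by simp), hv⟩ huv
    exact (ReachIn.of_adj hx hv huv).trans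
      (ih hv fun z hz => hp z (by simp [hz]))

theorem compIn_eq_compIn {G : SimpleGraph V} {s t : Set V} (hst : s ⊆ t)
    (h : ∀ x ∈ s, ∀ y ∈ t \ s, ¬ G.Adj x y) {x : V} (hx : x ∈ s) :
    compIn G t x = compIn G s x :=
  Set.ext fun _ => ⟨ReachIn.of_forall_not_adj h hx, ReachIn.mono hst⟩

theorem compIn_subset {G : SimpleGraph V} {s : Set V} {x : V} : compIn G s x ⊆ s :=
  fun _ h => ReachIn.right_mem h

theorem ConnIn.compIn_eq {G : SimpleGraph V} {s : Set V} (hs : ConnIn G s) {x : V} (hx : x ∈ s) :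
    compIn G s x = s :=
  compIn_subset.antisymm fun y hy => hs.2 x hx y hy

theorem ConnIn.compIn_eq_of_forall_not_adj {G : SimpleGraph V} {s t : Set V} (hs : ConnIn G s)
    (hst : s ⊆ t) (h : ∀ x ∈ s, ∀ y ∈ t \ s, ¬ G.Adj x y) {x : V} (hx : x ∈ s) :
    compIn G t x = s := by
  rw [compIn_eq_compIn hst h hx, hs.compIn_eq hx]

theorem ConnIn.subset_compIn {G : SimpleGraph V} {s t : Set V} (hs : ConnIn G s)
    (hst : s ⊆ t) {x : V} (hx : x ∈ s) : s ⊆ compIn G t x :=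
  fun y hy => (hs.2 x hx y hy).mono hst

theorem connIn_singleton (G : SimpleGraph V) (x : V) : ConnIn G {x} := by
  refine ⟨Set.singleton_nonempty x, ?_⟩
  rintro _ rfl _ rfl
  exact .refl rfl

theorem ConnIn.union {G : SimpleGraph V} {s t : Set V} (hs : ConnIn G s) (ht : ConnIn G t)
    {x y : V} (hx : x ∈ s) (hy : y ∈ t) (h : G.Adj x y) : ConnIn G (s ∪ t) := by
  have key : ∀ z ∈ s ∪ t, ReachIn G (s ∪ t) x z := by
    rintro z (hz | hz)
    · exact (hs.2 x hx z hz).mono Set.subset_union_left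
    · exact (ReachIn.of_adj (s := s ∪ t) (Or.inl hx) (Or.inr hy) h).trans
        ((ht.2 y hy z hz).mono Set.subset_union_right)
  exact ⟨⟨x, Or.inl hx⟩, fun a ha b hb => (key a ha).symm.trans (key b hb)⟩

theorem IsSearchTree.vertSet_eq {G : SimpleGraph V} {s : Set V} {T : RTree V}
    (h : IsSearchTree G s T) : T.vertSet = s := by
  cases h
  assumption

theorem IsSearchTree.exists_forall_mem_pathSet {G : SimpleGraph V} {s : Set V} {T : RTree V}
    (h : IsSearchTree G s T) {A : Set V} (hAs : A ⊆ s) (hA : ConnIn G A) :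
    ∃ u ∈ A, ∀ v ∈ A, u ∈ T.pathSet v := by
  induction h with
  | @node s r ts hr hs hts hp ih =>
    by_cases hrA : r ∈ A
    · exact ⟨r, hrA, fun v hv => RTree.root_mem_pathSet (hs ▸ hAs hv)⟩
    obtain ⟨x, hx⟩ := hA.1
    obtain rfl | ⟨t, ht, hxt⟩ := RTree.mem_vertSet_node.1 (hs ▸ hAs hx)
    · exact absurd hx hrA
    have hAr : A ⊆ s \ {r} := fun y hy => ⟨hAs hy, fun e => hrA (e ▸ hy)⟩
    rw [(hts t ht).vertSet_eq] at hxt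
    obtain ⟨u, hu, huA⟩ := ih t ht fun y hy => hxt.trans (hA.subset_compIn hAr hx hy)
    exact ⟨u, hu, fun v hv => RTree.pathSet_subset_pathSet_node ht (huA v hv)⟩

theorem IsSearchTree.node_cons {G : SimpleGraph V} {s t : Set V} {r : V} {ts : List (RTree V)}
    {T : RTree V} (hs : IsSearchTree G s (.node r ts)) (hT : IsSearchTree G t T)
    (ht : ConnIn G t) (hst : Disjoint s t) (hadj : ∀ x ∈ s, ∀ y ∈ t, G.Adj x y → x = r) :
    IsSearchTree G (s ∪ t) (.node r (T :: ts)) := by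
  have hrt : r ∈ s → r ∉ t := fun h h' => Set.disjoint_left.1 hst h h'
  cases hs with
  | node hr hvs hts hp =>
    have hT' : compIn G ((s ∪ t) \ {r}) T.root = t := by
      refine ht.compIn_eq_of_forall_not_adj ?_ ?_ (hT.vertSet_eq ▸ T.root_mem_vertSet)
      · exact fun y hy => ⟨Or.inr hy, fun e => hrt hr (e ▸ hy)⟩
      · rintro x hx y ⟨⟨hy | hy, hyr⟩, hyt⟩ hxy
        · exact hyr (hadj y hy x hx hxy.symm)
        · exact hyt hy
    have hmem : ∀ t' ∈ ts, t'.root ∈ s \ {r} := fun t' ht' => by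
      have h := (hts t' ht').vertSet_eq ▸ t'.root_mem_vertSet
      exact ReachIn.left_mem h
    have hcomp : ∀ t' ∈ ts, compIn G ((s ∪ t) \ {r}) t'.root = compIn G (s \ {r}) t'.root := by
      intro t' ht'
      refine compIn_eq_compIn (Set.sdiff_subset_sdiff_left Set.subset_union_left) ?_ (hmem t' ht')
      rintro x ⟨hx, hxr⟩ y ⟨⟨hy | hy, hyr⟩, hyt⟩ hxy
      · exact hyt ⟨hy, hyr⟩
      · exact hxr (hadj x hx y hy hxy)
    refine .node (Or.inl hr) ?_ ?_ ?_
    · ext v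
      rw [RTree.mem_vertSet_node, ← hvs, Set.mem_union, RTree.mem_vertSet_node, ← hT.vertSet_eq]
      simp only [List.mem_cons, exists_eq_or_imp, or_assoc]
      rw [or_comm (a := v ∈ T.vertSet)]
    · intro t' ht'
      rcases List.mem_cons.1 ht' with rfl | ht'
      · rwa [hT']
      · rw [hcomp t' ht']
        exact hts t' ht'
    · refine List.pairwise_cons.2 ⟨fun t' ht' e => ?_, ?_⟩
      · rw [hT', hcomp t' ht'] at e
        have : T.root ∈ s \ {r} := compIn_subset (e ▸ hT.vertSet_eq ▸ T.root_mem_vertSet)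
        exact Set.disjoint_left.1 hst this.1 (hT.vertSet_eq ▸ T.root_mem_vertSet)
      · exact hp.imp_of_mem fun h1 h2 h => by rwa [hcomp _ h1, hcomp _ h2]

theorem wsum_eq_mul_ncard [Finite V] {w : V → ℝ} {a : ℝ} (hw : ∀ x, w x = a) (s : Set V) :
    wsum w s = a * s.ncard := by
  rw [wsum, finsum_mem_eq_finite_toFinset_sum _ s.toFinite, Finset.sum_congr rfl fun x _ => hw x,
    Finset.sum_const, nsmul_eq_mul, Set.ncard_eq_toFinset_card s, mul_comm]

theorem IsCentroid.two_mul_ncard_le [Finite V] {G : SimpleGraph V} {w : V → ℝ} {a : ℝ}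
    (ha : 0 < a) (hw : ∀ x, w x = a) {s : Set V} {v : V} (hv : IsCentroid G w s v) {x : V}
    (hx : x ∈ s \ {v}) : 2 * (compIn G (s \ {v}) x).ncard ≤ s.ncard := by
  have h := hv.2 x hx
  rw [wsum_eq_mul_ncard hw, wsum_eq_mul_ncard hw, mul_div_assoc] at h
  have h' := le_of_mul_le_mul_left h ha
  have : (2 * (compIn G (s \ {v}) x).ncard : ℝ) ≤ s.ncard := by linarith
  exact_mod_cast this

theorem IsCentroid.two_mul_ncard_le_of_connIn [Finite V] {G : SimpleGraph V} {w : V → ℝ} {a : ℝ}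
    (ha : 0 < a) (hw : ∀ x, w x = a) {s : Set V} {v : V} (hv : IsCentroid G w s v) {D : Set V}
    (hD : ConnIn G D) (hDs : D ⊆ s) (hvD : v ∉ D) : 2 * D.ncard ≤ s.ncard := by
  obtain ⟨x, hx⟩ := hD.1
  have hDv : D ⊆ s \ {v} := fun y hy => ⟨hDs hy, fun e => hvD (e ▸ hy)⟩
  have := hv.two_mul_ncard_le ha hw (hDv hx)
  have := Set.ncard_le_ncard (hD.subset_compIn hDv hx)
  omega

theorem IsCentroidTree.of_mem_children {G : SimpleGraph V} {w : V → ℝ} {s : Set V} {r : V}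
    {ts : List (RTree V)} (h : IsCentroidTree G w s (.node r ts)) {t : RTree V} (ht : t ∈ ts) :
    IsCentroidTree G w (compIn G (s \ {r}) t.root) t := by
  obtain ⟨hs, hc⟩ := h
  cases hs with
  | node _ _ hts _ =>
    exact ⟨hts t ht, fun t' ht' => hc t' (RTree.mem_allSubtrees_node.2 (Or.inr ⟨t, ht, ht'⟩))⟩

theorem IsCentroidTree.isCentroid_root {G : SimpleGraph V} {w : V → ℝ} {s : Set V}
    {T : RTree V} (h : IsCentroidTree G w s T) : IsCentroid G w s T.root :=
  h.1.vertSet_eq ▸ h.2 T T.self_mem_allSubtrees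

theorem IsSearchTree.pathSet_subset_insert {G : SimpleGraph V} {s : Set V} {r : V}
    {ts : List (RTree V)} (h : IsSearchTree G s (.node r ts)) {t : RTree V} (ht : t ∈ ts) {v : V}
    (hv : v ∈ t.vertSet) : (RTree.node r ts).pathSet v ⊆ insert r (t.pathSet v) := by
  cases h with
  | node hr hvs hts hp =>
    rintro x ⟨p, hp', rfl, hx⟩
    obtain rfl | ⟨t', ht', q, hq, rfl⟩ := RTree.mem_pathsFrom_node.1 hp'
    · exact Or.inl (by simpa using hx)
    rcases List.mem_cons.1 hx with rfl | hx
    · exact Or.inl rfl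
    have hq' : q.1 ∈ t'.vertSet := ⟨q, hq, rfl⟩
    obtain rfl : t = t' := by
      by_contra hne
      have : Std.Symm fun t₁ t₂ : RTree V =>
          compIn G (s \ {r}) t₁.root ≠ compIn G (s \ {r}) t₂.root := ⟨fun _ _ h => h.symm⟩
      refine hp.forall ht ht' hne ?_
      rw [(hts t ht).vertSet_eq] at hv
      rw [(hts t' ht').vertSet_eq] at hq'
      have key : ReachIn G (s \ {r}) t.root t'.root := ReachIn.trans hv (ReachIn.symm hq')
      exact Set.ext fun y => ⟨fun hy => key.symm.trans hy, fun hy => key.trans hy⟩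
    exact Or.inr ⟨q, hq, rfl, hx⟩

theorem IsSearchTree.pathSet_root_subset {G : SimpleGraph V} {s : Set V} {r : V}
    {ts : List (RTree V)} (h : IsSearchTree G s (.node r ts)) :
    (RTree.node r ts).pathSet r ⊆ {r} := by
  cases h with
  | node hr hvs hts hp =>
    rintro x ⟨p, hp', hpr, hx⟩
    obtain rfl | ⟨t, ht, q, hq, rfl⟩ := RTree.mem_pathsFrom_node.1 hp'
    · simpa using hx
    have hq' : q.1 ∈ t.vertSet := ⟨q, hq, rfl⟩
    rw [(hts t ht).vertSet_eq] at hq'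
    exact absurd hpr (compIn_subset hq').2

theorem IsCentroidTree.two_pow_depth_le [Finite V] {G : SimpleGraph V} {w : V → ℝ} {a : ℝ}
    (ha : 0 < a) (hw : ∀ x, w x = a) {s : Set V} {T : RTree V} (h : IsCentroidTree G w s T)
    {v : V} (hv : v ∈ s) : 2 ^ T.depth v ≤ 2 * s.ncard := by
  obtain ⟨hs, hc⟩ := h
  induction hs with
  | @node s r ts hr hvs hts hp ih =>
    have hT : IsSearchTree G s (.node r ts) := .node hr hvs hts hp
    obtain rfl | ⟨t, ht, hvt⟩ := RTree.mem_vertSet_node.1 (hvs ▸ hv)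
    · have h1 : (RTree.node v ts).depth v ≤ 1 := by
        simpa [RTree.depth] using Set.ncard_le_ncard hT.pathSet_root_subset
      have h2 : 0 < s.ncard := (Set.ncard_pos).2 ⟨v, hr⟩
      calc 2 ^ (RTree.node v ts).depth v ≤ 2 ^ 1 := Nat.pow_le_pow_right two_pos h1
        _ ≤ 2 * s.ncard := by omega
    · have hc' := IsCentroidTree.of_mem_children ⟨hT, hc⟩ ht
      have h1 : (RTree.node r ts).depth v ≤ t.depth v + 1 :=
        (Set.ncard_le_ncard (hT.pathSet_subset_insert ht hvt)).trans (Set.ncard_insert_le _ _)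
      have h2 := ih t ht ((hts t ht).vertSet_eq ▸ hvt) hc'.2
      have h3 : t.root ∈ s \ {r} :=
        ReachIn.left_mem ((hts t ht).vertSet_eq ▸ t.root_mem_vertSet)
      have h4 := (IsCentroidTree.isCentroid_root ⟨hT, hc⟩).two_mul_ncard_le ha hw h3
      calc 2 ^ (RTree.node r ts).depth v ≤ 2 ^ (t.depth v + 1) := Nat.pow_le_pow_right two_pos h1
        _ = 2 * 2 ^ t.depth v := by ring
        _ ≤ 2 * s.ncard := Nat.mul_le_mul_left 2 (h2.trans h4)

/-- `IsSubdivBinomial G m r A`: the subgraph of `G` induced by `A` is the binomial tree on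
`2 ^ (m - 1)` vertices with root `r` and with every edge subdivided once. -/
inductive IsSubdivBinomial (G : SimpleGraph V) : ℕ → V → Set V → Prop
  | single (r : V) : IsSubdivBinomial G 1 r {r}
  | join {m : ℕ} {r r' c : V} {A B : Set V} :
      IsSubdivBinomial G m r A →
      IsSubdivBinomial G m r' B →
      c ∉ A → c ∉ B → Disjoint A B →
      (∀ x ∈ A, ∀ y ∈ B, ¬ G.Adj x y) →
      (∀ x ∈ A, G.Adj c x ↔ x = r) →
      (∀ x ∈ B, G.Adj c x ↔ x = r') →
      IsSubdivBinomial G (m + 1) r (insert c (A ∪ B))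

theorem ncard_inter_prod_add_le [Finite V] {R : Set (V × V)} {S A B D : Set V} {u : V}
    (hA : A ⊆ S) (hB : B ⊆ S) (hAB : Disjoint A B) (hu : u ∈ S) (hD : D ⊆ S)
    (huD : ∀ v ∈ D, (u, v) ∈ R) (huA : u ∈ A → Disjoint D A) (huB : u ∈ B → Disjoint D B) :
    (R ∩ A ×ˢ A).ncard + (R ∩ B ×ˢ B).ncard + D.ncard ≤ (R ∩ S ×ˢ S).ncard := by
  have h1 : Disjoint (R ∩ A ×ˢ A) (R ∩ B ×ˢ B) :=
    Set.disjoint_left.2 fun p hp hp' => Set.disjoint_left.1 hAB hp.2.1 hp'.2.1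
  have h2 : Disjoint (R ∩ A ×ˢ A ∪ R ∩ B ×ˢ B) (Prod.mk u '' D) := by
    rw [Set.disjoint_left]
    rintro _ (⟨-, h, h'⟩ | ⟨-, h, h'⟩) ⟨v, hv, rfl⟩
    · exact Set.disjoint_left.1 (huA h) hv h'
    · exact Set.disjoint_left.1 (huB h) hv h'
  rw [← Set.ncard_union_eq h1, ← Set.ncard_image_of_injective D (Prod.mk_right_injective u),
    ← Set.ncard_union_eq h2]
  refine Set.ncard_le_ncard ?_
  rintro p ((⟨hp, h, h'⟩ | ⟨hp, h, h'⟩) | ⟨v, hv, rfl⟩)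
  · exact ⟨hp, hA h, hA h'⟩
  · exact ⟨hp, hB h, hB h'⟩
  · exact ⟨huD v hv, hu, hD hv⟩

namespace IsSubdivBinomial

variable {G : SimpleGraph V} {m : ℕ} {r : V} {A : Set V}

theorem root_mem (h : IsSubdivBinomial G m r A) : r ∈ A := by
  induction h with
  | single r => rfl
  | join _ _ _ _ _ _ _ _ ih _ => exact Or.inr (Or.inl ih)

theorem connIn (h : IsSubdivBinomial G m r A) : ConnIn G A := by
  induction h with
  | single r => exact connIn_singleton G r
  | @join m r r' c A B hA hB _ _ _ _ hcA hcB ihA ihB =>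
    rw [Set.insert_eq, ← Set.union_assoc]
    exact ((connIn_singleton G c).union ihA rfl hA.root_mem ((hcA r hA.root_mem).2 rfl)).union ihB
      (Or.inl rfl) hB.root_mem ((hcB r' hB.root_mem).2 rfl)

theorem connIn_insert (h : IsSubdivBinomial G m r A) {c : V} (hc : ∀ x ∈ A, G.Adj c x ↔ x = r) :
    ConnIn G (insert c A) :=
  (connIn_singleton G c).union h.connIn rfl h.root_mem ((hc r h.root_mem).2 rfl)

theorem ncard_add_one [Finite V] (h : IsSubdivBinomial G m r A) : A.ncard + 1 = 2 ^ m := by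
  induction h with
  | single r => simp
  | join _ _ hcA hcB hAB _ _ _ ihA ihB =>
    rw [Set.ncard_insert_of_notMem (by simp [hcA, hcB]), Set.ncard_union_eq hAB, pow_succ]
    omega

theorem isTree [Finite V] (h : IsSubdivBinomial G m r Set.univ) : G.IsTree := by
  have key : ∀ {m r} {A : Set V}, IsSubdivBinomial G m r A →
      {e | e ∈ G.edgeSet ∧ ∀ x ∈ e, x ∈ A}.ncard + 1 ≤ A.ncard := by
    intro m r A h
    induction h with
    | single r =>
      have : {e | e ∈ G.edgeSet ∧ ∀ x ∈ e, x ∈ ({r} : Set V)} = ∅ := by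
        ext e
        induction e with | _ x y
        simp only [Set.mem_ofPred_eq, SimpleGraph.mem_edgeSet, Sym2.mem_iff,
          Set.mem_singleton_iff, Set.mem_empty_iff_false, iff_false]
        rintro ⟨hxy, h⟩
        exact hxy.ne ((h x (Or.inl rfl)).trans (h y (Or.inr rfl)).symm)
      rw [this]
      simp
    | @join m r r' c A B hA hB hcA hcB hAB hadj hrA hrB ihA ihB =>
      have hsub : {e | e ∈ G.edgeSet ∧ ∀ x ∈ e, x ∈ insert c (A ∪ B)} ⊆
          ({e | e ∈ G.edgeSet ∧ ∀ x ∈ e, x ∈ A} ∪ {e | e ∈ G.edgeSet ∧ ∀ x ∈ e, x ∈ B}) ∪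
            {s(c, r), s(c, r')} := by
        intro e
        induction e with | _ x y
        simp only [Set.mem_ofPred_eq, SimpleGraph.mem_edgeSet, Sym2.mem_iff, Set.mem_union,
          Set.mem_insert_iff, Set.mem_singleton_iff, forall_eq_or_imp, forall_eq]
        rintro ⟨hxy, rfl | hx | hx, rfl | hy | hy⟩
        · exact absurd rfl hxy.ne
        · exact Or.inr (Or.inl (by rw [(hrA y hy).1 hxy]))
        · exact Or.inr (Or.inr (by rw [(hrB y hy).1 hxy]))
        · exact Or.inr (Or.inl (by rw [(hrA x hx).1 hxy.symm, Sym2.eq_swap]))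
        · exact Or.inl (Or.inl ⟨hxy, hx, hy⟩)
        · exact absurd hxy (hadj x hx y hy)
        · exact Or.inr (Or.inr (by rw [(hrB x hx).1 hxy.symm, Sym2.eq_swap]))
        · exact absurd hxy.symm (hadj y hy x hx)
        · exact Or.inl (Or.inr ⟨hxy, hx, hy⟩)
      have h1 := Set.ncard_le_ncard hsub
      have h2 := Set.ncard_union_le
        ({e | e ∈ G.edgeSet ∧ ∀ x ∈ e, x ∈ A} ∪ {e | e ∈ G.edgeSet ∧ ∀ x ∈ e, x ∈ B})
        {s(c, r), s(c, r')}
      have h3 := Set.ncard_union_le {e | e ∈ G.edgeSet ∧ ∀ x ∈ e, x ∈ A}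
        {e | e ∈ G.edgeSet ∧ ∀ x ∈ e, x ∈ B}
      have h4 : ({s(c, r), s(c, r')} : Set (Sym2 V)).ncard ≤ 2 :=
        (Set.ncard_insert_le _ _).trans (by simp)
      rw [Set.ncard_insert_of_notMem (by simp [hcA, hcB]), Set.ncard_union_eq hAB]
      omega
  have : Nonempty V := ⟨r⟩
  have hconn : G.Connected :=
    { preconnected := fun x y => (h.connIn.2 x trivial y trivial).elim fun p _ => ⟨p⟩ }
  refine SimpleGraph.isTree_iff_connected_and_card.2 ⟨hconn, le_antisymm ?_ ?_⟩
  · have := key h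
    simp only [Set.mem_univ, implies_true, and_true, Set.ofPred_mem_eq, Set.ncard_univ] at this
    exact this
  · exact hconn.card_vert_le_card_edgeSet_add_one

theorem map {W : Type*} {H : SimpleGraph W} (f : G ↪g H) (h : IsSubdivBinomial G m r A) :
    IsSubdivBinomial H m (f r) (f '' A) := by
  induction h with
  | single r =>
    rw [Set.image_singleton]
    exact .single _
  | join hA hB hcA hcB hAB hadj hrA hrB ihA ihB =>
    rw [Set.image_insert_eq, Set.image_union]
    refine .join ihA ihB ?_ ?_ ((Set.disjoint_image_iff f.injective).2 hAB) ?_ ?_ ?_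
    · rwa [f.injective.mem_set_image]
    · rwa [f.injective.mem_set_image]
    · rintro _ ⟨x, hx, rfl⟩ _ ⟨y, hy, rfl⟩
      rw [f.map_adj_iff]
      exact hadj x hx y hy
    · rintro _ ⟨x, hx, rfl⟩
      rw [f.map_adj_iff, f.injective.eq_iff]
      exact hrA x hx
    · rintro _ ⟨x, hx, rfl⟩
      rw [f.map_adj_iff, f.injective.eq_iff]
      exact hrB x hx

/-- Two copies of a graph, with a new vertex joined to both copies of `r`. -/
def double {V : Type*} (G : SimpleGraph V) (r : V) : SimpleGraph (Option (V ⊕ V)) where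
  Adj
    | none, some (.inl x) => x = r
    | none, some (.inr x) => x = r
    | some (.inl x), none => x = r
    | some (.inr x), none => x = r
    | some (.inl x), some (.inl y) => G.Adj x y
    | some (.inr x), some (.inr y) => G.Adj x y
    | _, _ => False
  symm := ⟨by rintro (_ | x | x) (_ | y | y) h <;> first | exact h | exact SimpleGraph.Adj.symm h⟩
  loopless := ⟨by rintro (_ | x | x) h <;> first | exact h | exact h.ne rfl⟩

theorem exists_univ (m : ℕ) : ∃ (V : Type) (_ : Fintype V) (G : SimpleGraph V) (r : V),
    IsSubdivBinomial G (m + 1) r Set.univ := by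
  induction m with
  | zero =>
    refine ⟨Unit, inferInstance, ⊥, (), ?_⟩
    convert single (G := (⊥ : SimpleGraph Unit)) ()
    exact (Set.eq_univ_of_forall fun _ => rfl).symm
  | succ m ih =>
    obtain ⟨V, hV, G, r, h⟩ := ih
    let f : G ↪g double G r := ⟨⟨fun x => some (.inl x), fun x y h => by simpa using h⟩, Iff.rfl⟩
    let g : G ↪g double G r := ⟨⟨fun x => some (.inr x), fun x y h => by simpa using h⟩, Iff.rfl⟩
    refine ⟨Option (V ⊕ V), inferInstance, double G r, f r, ?_⟩
    convert join (c := none) (h.map f) (h.map g) ?_ ?_ ?_ ?_ ?_ ?_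
    · refine (Set.eq_univ_of_forall ?_).symm
      rintro (_ | x | x)
      · exact Or.inl rfl
      · exact Or.inr (Or.inl ⟨x, trivial, rfl⟩)
      · exact Or.inr (Or.inr ⟨x, trivial, rfl⟩)
    · rintro ⟨x, -, hx⟩
      exact Option.some_ne_none _ hx
    · rintro ⟨x, -, hx⟩
      exact Option.some_ne_none _ hx
    · rw [Set.disjoint_left]
      rintro _ ⟨x, -, rfl⟩ ⟨y, -, hy⟩
      exact Sum.inr_ne_inl (Option.some.inj hy)
    · rintro _ ⟨x, -, rfl⟩ _ ⟨y, -, rfl⟩ hxy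
      exact hxy
    · rintro _ ⟨x, -, rfl⟩
      rw [f.injective.eq_iff]
      rfl
    · rintro _ ⟨x, -, rfl⟩
      rw [g.injective.eq_iff]
      rfl

theorem mul_two_pow_le_ncard [Finite V] (h : IsSubdivBinomial G m r A) {R : Set (V × V)}
    (hR : ∀ B ⊆ A, ConnIn G B → ∃ u ∈ B, ∀ v ∈ B, (u, v) ∈ R) :
    m * 2 ^ m ≤ 2 * (R ∩ A ×ˢ A).ncard := by
  have hR' := hR A subset_rfl h.connIn
  induction h with
  | single r =>
    obtain ⟨u, rfl, hu⟩ := hR'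
    have : 0 < (R ∩ {u} ×ˢ {u}).ncard := (Set.ncard_pos).2 ⟨(u, u), hu u rfl, rfl, rfl⟩
    omega
  | @join m r r' c A B hA hB hcA hcB hAB hadj hrA hrB ihA ihB =>
    have hAS : A ⊆ insert c (A ∪ B) := fun x hx => Or.inr (Or.inl hx)
    have hBS : B ⊆ insert c (A ∪ B) := fun x hx => Or.inr (Or.inr hx)
    have h1 := ihA (fun D hD => hR D (hD.trans hAS)) (hR A hAS hA.connIn)
    have h2 := ihB (fun D hD => hR D (hD.trans hBS)) (hR B hBS hB.connIn)
    suffices (R ∩ A ×ˢ A).ncard + (R ∩ B ×ˢ B).ncard + 2 ^ m ≤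
        (R ∩ insert c (A ∪ B) ×ˢ insert c (A ∪ B)).ncard by
      rw [pow_succ]
      nlinarith
    have hcA' : (insert c A).ncard = 2 ^ m := by
      rw [Set.ncard_insert_of_notMem hcA, hA.ncard_add_one]
    have hcB' : (insert c B).ncard = 2 ^ m := by
      rw [Set.ncard_insert_of_notMem hcB, hB.ncard_add_one]
    have hcAS : insert c A ⊆ insert c (A ∪ B) := Set.insert_subset_insert Set.subset_union_left
    have hcBS : insert c B ⊆ insert c (A ∪ B) := Set.insert_subset_insert Set.subset_union_right
    have hdisjA : Disjoint (insert c B) A := Set.disjoint_insert_left.2 ⟨hcA, hAB.symm⟩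
    have hdisjB : Disjoint (insert c A) B := Set.disjoint_insert_left.2 ⟨hcB, hAB⟩
    obtain ⟨u, hu, huS⟩ := hR'
    by_cases huB : u ∈ B
    · rw [← hcA']
      exact ncard_inter_prod_add_le hAS hBS hAB hu hcAS (fun v hv => huS v (hcAS hv))
        (fun h => absurd huB (Set.disjoint_left.1 hAB h)) fun _ => hdisjB
    · rw [← hcB']
      exact ncard_inter_prod_add_le hAS hBS hAB hu hcBS (fun v hv => huS v (hcBS hv))
        (fun _ => hdisjA) fun h => absurd h huB

theorem two_pow_le_ncard_ancestorPairs [Finite V] (h : IsSubdivBinomial G m r A) {w : V → ℝ}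
    {a : ℝ} (ha : 0 < a) (hw : ∀ x, w x = a) {T : RTree V} (hT : IsCentroidTree G w A T) :
    m * 2 ^ m + 1 ≤ (T.ancestorPairs ∩ A ×ˢ A).ncard + 2 ^ m := by
  induction h generalizing T with
  | single r =>
    obtain ⟨u, rfl, hu⟩ := hT.1.exists_forall_mem_pathSet subset_rfl (connIn_singleton G r)
    have : 0 < (T.ancestorPairs ∩ {u} ×ˢ {u}).ncard :=
      (Set.ncard_pos).2 ⟨(u, u), hu u rfl, rfl, rfl⟩
    omega
  | @join m r r' c A B hA hB hcA hcB hAB hadj hrA hrB ihA ihB =>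
    have hAS : A ⊆ insert c (A ∪ B) := fun x hx => Or.inr (Or.inl hx)
    have hBS : B ⊆ insert c (A ∪ B) := fun x hx => Or.inr (Or.inr hx)
    have hcardA := hA.ncard_add_one
    have hcardB := hB.ncard_add_one
    have hcard : (insert c (A ∪ B)).ncard = A.ncard + B.ncard + 1 := by
      rw [Set.ncard_insert_of_notMem (by simp [hcA, hcB]), Set.ncard_union_eq hAB]
    have hroot : T.root = c := by
      have hc := hT.isCentroid_root
      rcases hc.1 with h | h | h
      · exact h
      · have hnot : T.root ∉ insert c B := by
          rintro (e | e)
          exacts [hcA (e ▸ h), Set.disjoint_left.1 hAB h e]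
        have := hc.two_mul_ncard_le_of_connIn ha hw (hB.connIn_insert hrB)
          (Set.insert_subset_insert Set.subset_union_right) hnot
        rw [Set.ncard_insert_of_notMem hcB] at this
        omega
      · have hnot : T.root ∉ insert c A := by
          rintro (e | e)
          exacts [hcB (e ▸ h), Set.disjoint_left.1 hAB e h]
        have := hc.two_mul_ncard_le_of_connIn ha hw (hA.connIn_insert hrA)
          (Set.insert_subset_insert Set.subset_union_left) hnot
        rw [Set.ncard_insert_of_notMem hcA] at this
        omega
    obtain ⟨q, ts⟩ := T
    obtain rfl : q = c := hroot
    have hchild : ∀ D ⊆ insert q (A ∪ B), q ∉ D → ConnIn G D →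
        (∀ x ∈ D, ∀ y ∈ (insert q (A ∪ B) \ {q}) \ D, ¬ G.Adj x y) →
        ∃ t ∈ ts, IsCentroidTree G w D t := by
      intro D hDS hqD hD hno
      obtain ⟨x, hx⟩ := hD.1
      have hxT : x ∈ (RTree.node q ts).vertSet := hT.1.vertSet_eq ▸ hDS hx
      obtain rfl | ⟨t, ht, hxt⟩ := RTree.mem_vertSet_node.1 hxT
      · exact absurd hx hqD
      have hct := hT.of_mem_children ht
      rw [hct.1.vertSet_eq] at hxt
      have hsub : D ⊆ insert q (A ∪ B) \ {q} := fun y hy => ⟨hDS hy, fun e => hqD (e ▸ hy)⟩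
      have hroot : t.root ∈ D := by
        have := ReachIn.symm hxt
        exact (ReachIn.of_forall_not_adj hno hx this).right_mem
      rw [hD.compIn_eq_of_forall_not_adj hsub hno hroot] at hct
      exact ⟨t, ht, hct⟩
    have hmono : ∀ t ∈ ts, ∀ D : Set V, (t.ancestorPairs ∩ D ×ˢ D).ncard ≤
        ((RTree.node q ts).ancestorPairs ∩ D ×ˢ D).ncard := fun t ht D =>
      Set.ncard_le_ncard fun p hp => ⟨RTree.pathSet_subset_pathSet_node ht hp.1, hp.2⟩
    obtain ⟨t, ht, hct⟩ := hchild A hAS hcA hA.connIn (by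
      rintro x hx y ⟨⟨rfl | hy | hy, hyq⟩, hyA⟩
      exacts [absurd rfl hyq, absurd hy hyA, hadj x hx y hy])
    obtain ⟨t', ht', hct'⟩ := hchild B hBS hcB hB.connIn (by
      rintro x hx y ⟨⟨rfl | hy | hy, hyq⟩, hyB⟩ hxy
      exacts [hyq rfl, hadj y hy x hx hxy.symm, hyB hy])
    have h1 := (ihA hct).trans (Nat.add_le_add_right (hmono t ht A) _)
    have h2 := (ihB hct').trans (Nat.add_le_add_right (hmono t' ht' B) _)
    have h3 := ncard_inter_prod_add_le (R := (RTree.node q ts).ancestorPairs)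
      (D := insert q (A ∪ B)) (u := q) hAS hBS hAB (Or.inl rfl) subset_rfl
      (fun v hv => RTree.root_mem_pathSet (hT.1.vertSet_eq ▸ hv)) (fun h => absurd h hcA)
      fun h => absurd h hcB
    rw [pow_succ]
    nlinarith

theorem exists_isSearchTree [Finite V] (h : IsSubdivBinomial G m r A) :
    ∃ ts, IsSearchTree G A (.node r ts) ∧ (RTree.node r ts).pathsFrom.length + 1 = 2 ^ m ∧
      2 * (RTree.node r ts).totalLength + 4 = m * 2 ^ m + 2 * 2 ^ m := by
  have leaf (c : V) : IsSearchTree G {c} (.node c []) := by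
    refine .node rfl ?_ (by simp) .nil
    ext v
    simp [RTree.mem_vertSet_node]
  induction h with
  | single r =>
    exact ⟨[], leaf r, by simp [RTree.length_pathsFrom_leaf], by simp [RTree.totalLength_leaf]⟩
  | @join m r r' c A B hA hB hcA hcB hAB hadj hrA hrB ihA ihB =>
    obtain ⟨ts, hts, hlen, htot⟩ := ihA
    obtain ⟨ts', hts', hlen', htot'⟩ := ihB
    have hT' : IsSearchTree G (B ∪ {c}) (.node r' (.node c [] :: ts')) := by
      refine hts'.node_cons (leaf c) (connIn_singleton G c) (by simpa using hcB) ?_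
      rintro x hx _ rfl hxc
      exact (hrB x hx).1 hxc.symm
    have hconn : ConnIn G (B ∪ {c}) := by
      rw [Set.union_singleton]
      exact hB.connIn_insert hrB
    have hT := hts.node_cons hT' hconn (by simp [hcA, hAB]) (by
      rintro x hx y (hy | rfl) hxy
      exacts [absurd hxy (hadj x hx y hy), (hrA x hx).1 hxy.symm])
    refine ⟨_, by rwa [← Set.union_assoc, Set.union_singleton] at hT, ?_, ?_⟩
    · simp only [RTree.length_pathsFrom_node_cons, RTree.length_pathsFrom_leaf, pow_succ]
      omega
    · simp only [RTree.totalLength_node_cons, RTree.length_pathsFrom_node_cons,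
        RTree.length_pathsFrom_leaf, RTree.totalLength_leaf, pow_succ]
      nlinarith

end IsSubdivBinomial

theorem IsSubdivBinomial.le_cost [Finite V] {G : SimpleGraph V} {m : ℕ} {r : V}
    (h : IsSubdivBinomial G m r Set.univ) {w : V → ℝ}
    (hw : ∀ x, w x = 1 / (Nat.card V : ℝ)) {T : RTree V} (hT : IsSearchTree G Set.univ T) :
    (m : ℝ) / 2 ≤ cost w T := by
  have hN : (Nat.card V : ℝ) + 1 = 2 ^ m := by exact_mod_cast Set.ncard_univ V ▸ h.ncard_add_one
  have : Nonempty V := ⟨r⟩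
  have hpos : (0 : ℝ) < Nat.card V := by exact_mod_cast Nat.card_pos
  have hp := h.mul_two_pow_le_ncard (R := T.ancestorPairs) fun B hB hconn =>
    hT.exists_forall_mem_pathSet hB hconn
  rw [Set.univ_prod_univ, Set.inter_univ] at hp
  have hp' : (m : ℝ) * 2 ^ m ≤ 2 * T.ancestorPairs.ncard := by exact_mod_cast hp
  rw [RTree.cost_eq_ncard_ancestorPairs hw hT.vertSet_eq, one_div_mul_eq_div,
    div_le_div_iff₀ two_pos hpos]
  rw [← hN] at hp'
  nlinarith [(Nat.cast_nonneg m : (0 : ℝ) ≤ m)]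

theorem IsSubdivBinomial.exists_cost_le [Finite V] {G : SimpleGraph V} {m : ℕ} {r : V}
    (h : IsSubdivBinomial G m r Set.univ) {w : V → ℝ}
    (hw : ∀ x, w x = 1 / (Nat.card V : ℝ)) :
    ∃ T, IsSearchTree G Set.univ T ∧ cost w T ≤ (m : ℝ) / 2 + 3 := by
  obtain ⟨ts, hT, -, htot⟩ := h.exists_isSearchTree
  refine ⟨_, hT, ?_⟩
  have hN' := Set.ncard_univ V ▸ h.ncard_add_one
  have hN : (Nat.card V : ℝ) + 1 = 2 ^ m := by exact_mod_cast hN'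
  have : Nonempty V := ⟨r⟩
  have hone : (1 : ℝ) ≤ Nat.card V := by exact_mod_cast Nat.card_pos
  have hm : (m : ℝ) ≤ Nat.card V := by
    have := m.lt_two_pow_self
    exact_mod_cast (by omega : m ≤ Nat.card V)
  have hle : ((RTree.node r ts).ancestorPairs.ncard : ℝ) ≤ (RTree.node r ts).totalLength := by
    exact_mod_cast RTree.ncard_ancestorPairs_le _
  have htot' : 2 * ((RTree.node r ts).totalLength : ℝ) + 4 = m * 2 ^ m + 2 * 2 ^ m := by
    exact_mod_cast htot
  rw [RTree.cost_eq_ncard_ancestorPairs hw hT.vertSet_eq, one_div_mul_eq_div,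
    div_le_iff₀ (by linarith)]
  rw [← hN] at htot'
  nlinarith

theorem IsSubdivBinomial.cost_centroidTree_mem_Icc [Finite V] {G : SimpleGraph V} {m : ℕ} {r : V}
    (h : IsSubdivBinomial G m r Set.univ) {w : V → ℝ}
    (hw : ∀ x, w x = 1 / (Nat.card V : ℝ)) {C : RTree V}
    (hC : IsCentroidTree G w Set.univ C) : cost w C ∈ Set.Icc ((m : ℝ) - 1) m := by
  have hN' := Set.ncard_univ V ▸ h.ncard_add_one
  have hN : (Nat.card V : ℝ) + 1 = 2 ^ m := by exact_mod_cast hN'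
  have : Nonempty V := ⟨r⟩
  have hpos : (0 : ℝ) < Nat.card V := by exact_mod_cast Nat.card_pos
  have ha : 0 < 1 / (Nat.card V : ℝ) := by positivity
  constructor
  · have hp := h.two_pow_le_ncard_ancestorPairs ha hw hC
    rw [Set.univ_prod_univ, Set.inter_univ] at hp
    have hp' : (m : ℝ) * 2 ^ m + 1 ≤ C.ancestorPairs.ncard + 2 ^ m := by exact_mod_cast hp
    rw [RTree.cost_eq_ncard_ancestorPairs hw hC.1.vertSet_eq, one_div_mul_eq_div,
      le_div_iff₀ hpos]
    rw [← hN] at hp'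
    nlinarith [(Nat.cast_nonneg m : (0 : ℝ) ≤ m)]
  · have hdepth (v : V) : C.depth v ≤ m := by
      have h1 := hC.two_pow_depth_le ha hw (Set.mem_univ v)
      rw [Set.ncard_univ] at h1
      have h2 : 2 ^ C.depth v < 2 ^ (m + 1) := by
        rw [pow_succ]
        omega
      exact Nat.lt_succ_iff.1 ((Nat.pow_lt_pow_iff_right one_lt_two).1 h2)
    have := Fintype.ofFinite V
    simp only [cost, hC.1.vertSet_eq, Set.mem_univ, finsum_true, hw]
    rw [finsum_eq_sum_of_fintype, ← Finset.mul_sum, one_div_mul_eq_div, div_le_iff₀ hpos]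
    calc ∑ v, (C.depth v : ℝ) ≤ ∑ _v : V, (m : ℝ) :=
          Finset.sum_le_sum fun v _ => by exact_mod_cast hdepth v
      _ = m * Nat.card V := by simp [mul_comm]

theorem IsSubdivBinomial.OPT_mem_Icc [Finite V] {G : SimpleGraph V} {m : ℕ} {r : V}
    (h : IsSubdivBinomial G m r Set.univ) {w : V → ℝ}
    (hw : ∀ x, w x = 1 / (Nat.card V : ℝ)) :
    OPT G w Set.univ ∈ Set.Icc ((m : ℝ) / 2) ((m : ℝ) / 2 + 3) := by
  obtain ⟨T, hT, hcost⟩ := h.exists_cost_le hw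
  have hlow : ∀ b ∈ cost w '' {T | IsSearchTree G Set.univ T}, (m : ℝ) / 2 ≤ b := by
    rintro _ ⟨T', hT', rfl⟩
    exact h.le_cost hw hT'
  exact ⟨le_csInf ⟨_, T, hT, rfl⟩ hlow, (csInf_le ⟨_, hlow⟩ ⟨T, hT, rfl⟩).trans hcost⟩

theorem lower_bound_unweighted :
    ∃ (V : ℕ → Type) (_ : ∀ n, Fintype (V n)) (G : ∀ n, SimpleGraph (V n))
      (w : ∀ n, V n → ℝ),
      (∀ n, (G n).IsTree) ∧
      (∀ n, ∀ x : V n, w n x = 1 / (Nat.card (V n) : ℝ)) ∧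
      Filter.Tendsto (fun n => OPT (G n) (w n) Set.univ) Filter.atTop Filter.atTop ∧
      (∀ C : (n : ℕ) → RTree (V n), (∀ n, IsCentroidTree (G n) (w n) Set.univ (C n)) →
        Filter.Tendsto (fun n => cost (w n) (C n) / OPT (G n) (w n) Set.univ)
          Filter.atTop (nhds 2)) := by
  choose V hV G r h using IsSubdivBinomial.exists_univ
  have hw : ∀ n, ∀ _ : V n, 1 / (Nat.card (V n) : ℝ) = 1 / (Nat.card (V n) : ℝ) :=
    fun _ _ => rfl
  have hOPT n := (h n).OPT_mem_Icc (hw n)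
  have htop : Tendsto (fun n : ℕ => ((n + 1 : ℕ) : ℝ) / 2) atTop atTop :=
    (tendsto_natCast_atTop_atTop.comp (tendsto_add_atTop_nat 1)).atTop_div_const two_pos
  refine ⟨V, hV, G, fun n _ => 1 / (Nat.card (V n) : ℝ), fun n => (h n).isTree, hw,
    tendsto_atTop_mono (fun n => (hOPT n).1) htop, fun C hC => ?_⟩
  have hlim : Tendsto (fun n : ℕ => 2 - 7 / (((n + 1 : ℕ) : ℝ) / 2 + 3)) atTop (nhds 2) := by
    simpa using tendsto_const_nhds.sub
      ((tendsto_atTop_add_const_right _ (3 : ℝ) htop).const_div_atTop (7 : ℝ))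
  refine tendsto_of_tendsto_of_tendsto_of_le_of_le hlim tendsto_const_nhds
    (fun n => ?_) fun n => ?_
  all_goals
    have hm : (1 : ℝ) ≤ (n + 1 : ℕ) := by exact_mod_cast Nat.le_add_left 1 n
    have hC' := (h n).cost_centroidTree_mem_Icc (hw n) (hC n)
    have hO := hOPT n
    have hpos := lt_of_lt_of_le (by linarith : (0 : ℝ) < ((n + 1 : ℕ) : ℝ) / 2) hO.1
  · calc 2 - 7 / (((n + 1 : ℕ) : ℝ) / 2 + 3)
        = (((n + 1 : ℕ) : ℝ) - 1) / (((n + 1 : ℕ) : ℝ) / 2 + 3) := by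
          field_simp
          ring
      _ ≤ (((n + 1 : ℕ) : ℝ) - 1) / OPT (G n) (fun _ => 1 / (Nat.card (V n) : ℝ)) Set.univ :=
          div_le_div_of_nonneg_left (by linarith) hpos hO.2
      _ ≤ _ := div_le_div_of_nonneg_right hC'.1 hpos.le
  · rw [div_le_iff₀ hpos]
    linarith [hC'.2, hO.1]
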